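/- arXiv:1602.03231 — 2 statements merged into one kernel-verified Lean document; each statement's English description precedes it below -/
import Mathlib

section
/- Let w = a·ψ(v)·b be a proper Christoffel word. The depth of w (the least d ≥ 0 such that the d-th derivative ∂^d w is a single letter) is equal to the height h(v) of its directive word v. -/
namespace Chri

/-- Length of the longest palindromic suffix of `w`. -/
def lpsLen (w : List Bool) : ℕ :=
  ((List.range (w.length + 1)).filter
    (fun l => w.drop (w.length - l) == (w.drop (w.length - l)).reverse)).foldr max 0

/-- Right palindromic closure: the shortest palindrome having `w` as a prefix. -/
def palClosure (w : List Bool) : List Bool :=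
  w ++ (w.take (w.length - lpsLen w)).reverse

/-- The iterated palindromization map ψ. -/
def psi (v : List Bool) : List Bool :=
  v.foldl (fun w x => palClosure (w ++ [x])) []

/-- Apply a substitution (morphism of the free monoid) letter by letter. -/
def applyM (f : Bool → List Bool) (w : List Bool) : List Bool := (w.map f).flatten

/-- μ_x : x ↦ x, y ↦ xy (a = false, b = true). -/
def muL (x : Bool) : List Bool → List Bool :=
  applyM (fun y => if y = x then [x] else [x, y])

/-- λ_a = μ_a; λ_b : a ↦ ab, b ↦ b. -/
def lamL : Bool → List Bool → List Bool
  | false => applyM (fun y => if y = false then [false] else [false, true])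
  | true  => applyM (fun y => if y = true then [true] else [false, true])

/-- μ_{v₁⋯v_n} = μ_{v₁} ∘ ⋯ ∘ μ_{v_n}. -/
def muW : List Bool → List Bool → List Bool
  | [], w => w
  | x :: v, w => muL x (muW v w)

/-- λ_{v₁⋯v_n} = λ_{v₁} ∘ ⋯ ∘ λ_{v_n}. -/
def lamW : List Bool → List Bool → List Bool
  | [], w => w
  | x :: v, w => lamL x (lamW v w)

/-- Christoffel words: the letters and the words aψ(v)b. -/
def IsChristoffel (w : List Bool) : Prop :=
  w = [false] ∨ w = [true] ∨ ∃ v, w = false :: (psi v ++ [true])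

/-- A word is constant if it is a power of a single letter. -/
def IsConstant (v : List Bool) : Prop := ∃ x n, v = List.replicate n x

/-- ₊v : the longest proper suffix of v immediately preceded by the complement of
the first letter of v. -/
def plusV (v : List Bool) : List Bool :=
  (v.dropWhile (fun y => y == v.headD false)).tail

/-- v₊ : the longest proper prefix of v immediately followed by the complement of
the last letter of v. -/
def vPlus (v : List Bool) : List Bool := (plusV v.reverse).reverse

/-- α₀: the length of the first maximal block of `v` (the index). -/
def blockLen (v : List Bool) : ℕ :=
  (v.takeWhile (fun y => y == v.headD false)).length

/-- The list of lengths of the maximal blocks of equal letters of `v`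
(the integral representation (α₀, …, α_n)). -/
def blockLens : List Bool → List ℕ
  | [] => []
  | [_] => [1]
  | x :: y :: v =>
    if x = y then
      match blockLens (y :: v) with
      | [] => [1]
      | n :: ns => (n + 1) :: ns
    else 1 :: blockLens (y :: v)

/-- ext(v) = number of maximal blocks of v. -/
def ext (v : List Bool) : ℕ := (blockLens v).length

/-- π(w): the minimal period of `w` (with π(ε) = 1). -/
noncomputable def minPeriod (w : List Bool) : ℕ :=
  sInf {p | 0 < p ∧ ∀ i, i + p < w.length → w.getD i false = w.getD (i + p) false}

/-- φ_k : a ↦ a^{k+1} b, b ↦ a^k b. -/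
def phi (k : ℕ) : List Bool → List Bool :=
  applyM (fun y => if y = false then List.replicate (k + 1) false ++ [true]
                   else List.replicate k false ++ [true])

/-- φ̂_k : a ↦ a b^k, b ↦ a b^{k+1}. -/
def phiHat (k : ℕ) : List Bool → List Bool :=
  applyM (fun y => if y = false then false :: List.replicate k true
                   else false :: List.replicate (k + 1) true)

attribute [local instance] Classical.propDecidable

/-- The derivative ∂w of a proper Christoffel word w = aψ(v)b of index k:
∂(ab) = a, and otherwise the preimage of w under φ_k (if v starts with a)
or φ̂_k (if v starts with b). -/
noncomputable def derivC (w : List Bool) : List Bool :=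
  if w = [false, true] then [false]
  else if h : ∃ v, v ≠ [] ∧ w = false :: (psi v ++ [true]) then
    if h.choose.headD false = false then Function.invFun (phi (blockLen h.choose)) w
    else Function.invFun (phiHat (blockLen h.choose)) w
  else w

/-- The depth of a Christoffel word: the least d with ∂^d w a single letter. -/
noncomputable def depth (w : List Bool) : ℕ :=
  sInf {d | derivC^[d] w = [false] ∨ derivC^[d] w = [true]}

/-- The height h(v): the least n ≥ 1 such that v_(n) is constant, where
v_(1) = v and v_(n+1) = ₊(v_(n)). -/
noncomputable def height (v : List Bool) : ℕ :=
  sInf {n | 0 < n ∧ IsConstant (plusV^[n - 1] v)}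

/-- Helper computing δ_i from (α_{i-1}, δ_{i-1}) along the remaining exponents. -/
def ruleAux : ℕ → ℕ → List ℕ → List ℕ
  | _, _, [] => []
  | pa, pd, a :: rest =>
    let d := if 1 < a then 1 else if 1 < pa then 0 else 1 - pd
    d :: ruleAux a d rest

/-- The sequence δ₀, δ₁, …, δ_n computed by the recursive rule (δ₀ = 1). -/
def ruleSeq : List ℕ → List ℕ
  | [] => []
  | a :: rest => 1 :: ruleAux a 1 rest

/-- δ(v) = Σ_{i=0}^n δ_i(v), where additionally δ_n(v) = 1; δ(ε) = 1. -/
def delta (v : List Bool) : ℕ := ((ruleSeq (blockLens v)).dropLast).sum + 1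

/-- |u₁|: length of the longest prefix x₀⋯x_i of u with i < n and α₀ = ⋯ = α_i = 1
(and 0 if α₀ > 1 or n = 0). -/
def u1len (u : List Bool) : ℕ :=
  min ((blockLens u).takeWhile (fun n => n == 1)).length ((blockLens u).length - 1)

/-- |u₂|: the symmetric notion for suffixes. -/
def u2len (u : List Bool) : ℕ := u1len u.reverse

/-- The sequence H: H(1) = 0, H(2n) = H(n), H(4n±1) = H(n)+1. -/
def H : ℕ → ℕ
  | 0 => 0
  | 1 => 0
  | n + 2 =>
    if (n + 2) % 2 = 0 then H ((n + 2) / 2)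
    else if (n + 2) % 4 = 1 then H ((n + 2) / 4) + 1
    else H ((n + 3) / 4) + 1
decreasing_by all_goals omega

/-- ⟨w⟩: the word w read as an integer in base 2 (a = 0, b = 1). -/
def wordVal (w : List Bool) : ℕ :=
  w.foldl (fun acc x => 2 * acc + (if x then 1 else 0)) 0

/-- Membership in X^*: w is a concatenation of words of X. -/
def InStar (X : Set (List Bool)) (w : List Bool) : Prop :=
  ∃ l : List (List Bool), (∀ u ∈ l, u ∈ X) ∧ w = l.flatten

/-- w ∈ x⁺. -/
def PowPos (x : Bool) (w : List Bool) : Prop := ∃ k, 0 < k ∧ w = List.replicate k x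

/-! ### The palindromic closure -/

lemma le_foldr_max {a : ℕ} {l : List ℕ} (h : a ∈ l) : a ≤ l.foldr max 0 := by
  induction l with
  | nil => simp at h
  | cons b l ih =>
    rcases List.mem_cons.1 h with rfl | h
    · simp
    · simpa using Or.inr (ih h)

lemma foldr_max_mem_or_eq_zero (l : List ℕ) : l.foldr max 0 ∈ l ∨ l.foldr max 0 = 0 := by
  induction l with
  | nil => simp
  | cons b l ih =>
    rcases le_total b (l.foldr max 0) with h | h
    · rcases ih with ih | ih
      · left; simp [max_eq_right h, ih]
      · right; rw [List.foldr_cons, max_eq_right h, ih]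
    · left; simp [max_eq_left h]

lemma lpsLen_le_length (w : List Bool) : lpsLen w ≤ w.length := by
  unfold lpsLen
  rcases foldr_max_mem_or_eq_zero ((List.range (w.length + 1)).filter
    (fun l => w.drop (w.length - l) == (w.drop (w.length - l)).reverse)) with h | h
  · have := (List.mem_filter.1 h).1
    rw [List.mem_range] at this
    omega
  · omega

lemma reverse_drop_lpsLen (w : List Bool) :
    (w.drop (w.length - lpsLen w)).reverse = w.drop (w.length - lpsLen w) := by
  unfold lpsLen
  rcases foldr_max_mem_or_eq_zero ((List.range (w.length + 1)).filter
    (fun l => w.drop (w.length - l) == (w.drop (w.length - l)).reverse)) with h | h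
  · have := (List.mem_filter.1 h).2
    exact (beq_iff_eq.1 this).symm
  · rw [h]; simp

lemma length_le_lpsLen {p q : List Bool} (hq : q.reverse = q) : q.length ≤ lpsLen (p ++ q) := by
  unfold lpsLen
  refine le_foldr_max (List.mem_filter.2 ⟨?_, ?_⟩)
  · simp
  · simp [hq]

/-- Every word splits as `p ++ q` with `q` its longest palindromic suffix, and then its
palindromic closure is `p ++ q ++ p.reverse`. -/
lemma exists_longest_palindromic_suffix (w : List Bool) :
    ∃ p q, w = p ++ q ∧ q.reverse = q ∧
      (∀ p' q', w = p' ++ q' → q'.reverse = q' → q'.length ≤ q.length) ∧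
      palClosure w = w ++ p.reverse := by
  refine ⟨w.take (w.length - lpsLen w), w.drop (w.length - lpsLen w), by simp,
    reverse_drop_lpsLen w, ?_, rfl⟩
  rintro p' q' rfl hq
  have h := length_le_lpsLen (p := p') hq
  have h' := lpsLen_le_length (p' ++ q')
  rw [List.length_drop]
  omega

lemma palClosure_eq {p q : List Bool} (hq : q.reverse = q)
    (hmax : ∀ p' q', p ++ q = p' ++ q' → q'.reverse = q' → q'.length ≤ q.length) :
    palClosure (p ++ q) = p ++ q ++ p.reverse := by
  have h₁ := length_le_lpsLen (p := p) hq
  have h₂ := lpsLen_le_length (p ++ q)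
  have h₃ := hmax _ _ (List.take_append_drop ((p ++ q).length - lpsLen (p ++ q)) _).symm
    (reverse_drop_lpsLen _)
  rw [List.length_drop] at h₃
  have h : (p ++ q).length - lpsLen (p ++ q) = p.length := by
    simp only [List.length_append] at *
    omega
  unfold palClosure
  rw [h, List.take_left]

/-! ### The morphisms `muL` and `lamL` -/

lemma applyM_append (f : Bool → List Bool) (u v : List Bool) :
    applyM f (u ++ v) = applyM f u ++ applyM f v := by
  simp [applyM]

lemma applyM_cons (f : Bool → List Bool) (c : Bool) (v : List Bool) :
    applyM f (c :: v) = f c ++ applyM f v := by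
  simp [applyM]

@[simp] lemma muL_nil (x : Bool) : muL x [] = [] := rfl

@[simp] lemma muL_cons_self (x : Bool) (u : List Bool) : muL x (x :: u) = x :: muL x u := by
  simp [muL, applyM]

@[simp] lemma muL_cons_not (x : Bool) (u : List Bool) :
    muL x ((!x) :: u) = x :: (!x) :: muL x u := by
  simp [muL, applyM]

@[simp] lemma muL_append (x : Bool) (u v : List Bool) : muL x (u ++ v) = muL x u ++ muL x v :=
  applyM_append _ _ _

lemma eq_or_eq_not (x y : Bool) : y = x ∨ y = !x := by
  cases x <;> cases y <;> simp

lemma muL_ne_not_cons (x : Bool) (u l : List Bool) : muL x u ≠ (!x) :: l := by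
  rcases u with _ | ⟨c, u⟩
  · simp
  · rcases eq_or_eq_not x c with rfl | rfl <;> simp

lemma muL_injective (x : Bool) : Function.Injective (muL x) := by
  intro u
  induction u with
  | nil =>
    rintro (_ | ⟨d, v⟩) h
    · rfl
    · rcases eq_or_eq_not x d with rfl | rfl <;> simp at h
  | cons c u ih =>
    rintro (_ | ⟨d, v⟩) h
    · rcases eq_or_eq_not x c with rfl | rfl <;> simp at h
    · rcases eq_or_eq_not x c with rfl | rfl
      · rcases eq_or_eq_not c d with rfl | rfl
        · simp only [muL_cons_self, List.cons.injEq, true_and] at h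
          rw [ih h]
        · simp only [muL_cons_self, muL_cons_not, List.cons.injEq, true_and] at h
          exact (muL_ne_not_cons _ _ _ h).elim
      · rcases eq_or_eq_not x d with rfl | rfl
        · simp only [muL_cons_self, muL_cons_not, List.cons.injEq, true_and] at h
          exact (muL_ne_not_cons _ _ _ h.symm).elim
        · simp only [muL_cons_not, List.cons.injEq, true_and] at h
          rw [ih h]

lemma cons_reverse_muL (x : Bool) (u : List Bool) :
    x :: (muL x u).reverse = muL x u.reverse ++ [x] := by
  induction u with
  | nil => rfl
  | cons c u ih =>
    rcases eq_or_eq_not x c with rfl | rfl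
    · simp [← List.cons_append, ih]
    · simp [← List.cons_append, ih]

lemma reverse_muL_append_singleton_eq_iff (x : Bool) (u : List Bool) :
    (muL x u ++ [x]).reverse = muL x u ++ [x] ↔ u.reverse = u := by
  rw [List.reverse_append, List.reverse_singleton, List.singleton_append, cons_reverse_muL,
    List.append_left_inj]
  exact (muL_injective x).eq_iff

/-- Every occurrence of `x` in `muL x w ++ [x]` starts the image of a suffix of `w`. -/
lemma exists_split_of_muL_append_eq {x : Bool} {w P R : List Bool}
    (h : muL x w ++ [x] = P ++ x :: R) :
    ∃ p q, w = p ++ q ∧ P = muL x p ∧ x :: R = muL x q ++ [x] := by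
  induction w generalizing P with
  | nil =>
    rcases P with _ | ⟨c, P⟩
    · exact ⟨[], [], rfl, rfl, by simpa using h.symm⟩
    · simp at h
  | cons c w ih =>
    rcases P with _ | ⟨d, P⟩
    · exact ⟨[], c :: w, rfl, rfl, h.symm⟩
    · rcases eq_or_eq_not x c with rfl | rfl
      · simp only [muL_cons_self, List.cons_append, List.cons.injEq] at h
        obtain ⟨p, q, rfl, rfl, hq⟩ := ih h.2
        exact ⟨c :: p, q, rfl, by simp [h.1], hq⟩
      · rcases P with _ | ⟨e, P⟩
        · simp at h
        · simp only [muL_cons_not, List.cons_append, List.cons.injEq] at h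
          obtain ⟨p, q, rfl, rfl, hq⟩ := ih h.2.2
          exact ⟨(!x) :: p, q, rfl, by rw [muL_cons_not, ← h.1, ← h.2.1], hq⟩

/-- In `muL x w` every letter other than `x` is preceded by `x`. -/
lemma exists_eq_append_of_muL_eq {x : Bool} {w P Q : List Bool} (h : muL x w = P ++ (!x) :: Q) :
    ∃ P', P = P' ++ [x] := by
  induction w generalizing P with
  | nil => simp at h
  | cons c w ih =>
    rcases P with _ | ⟨d, P⟩
    · exact (muL_ne_not_cons _ _ _ h).elim
    · rcases eq_or_eq_not x c with rfl | rfl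
      · simp only [muL_cons_self, List.cons_append, List.cons.injEq] at h
        obtain ⟨P', rfl⟩ := ih h.2
        exact ⟨d :: P', rfl⟩
      · rcases P with _ | ⟨e, P⟩
        · simp only [muL_cons_not, List.cons_append, List.cons.injEq] at h
          exact ⟨[], by simp [h.1]⟩
        · simp only [muL_cons_not, List.cons_append, List.cons.injEq] at h
          obtain ⟨P', rfl⟩ := ih h.2.2
          exact ⟨d :: e :: P', rfl⟩

lemma length_muL_le_of_append_eq {x : Bool} {p q p' q' : List Bool} (h : p ++ q = p' ++ q')
    (hl : q'.length ≤ q.length) : (muL x q').length ≤ (muL x q).length := by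
  obtain ⟨r, rfl⟩ : q' <:+ q :=
    List.suffix_of_suffix_length_le ⟨p', h.symm⟩ ⟨p, rfl⟩ hl
  simp

/-! ### Justin's formula -/

lemma head_eq_of_reverse_eq {c y : Bool} {Q W P : List Bool} (hQ : (c :: Q).reverse = c :: Q)
    (h : W ++ [y] = P ++ c :: Q) : c = y := by
  have := congrArg List.reverse h
  rw [List.reverse_append, List.reverse_append, hQ] at this
  simp only [List.reverse_singleton, List.cons_append, List.cons.injEq] at this
  exact this.1.symm

lemma palClosure_muL_append (x y : Bool) (u : List Bool) :
    palClosure (muL x u ++ [x, y]) = muL x (palClosure (u ++ [y])) ++ [x] := by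
  obtain ⟨p, q, hw, hq, hmax, hcl⟩ := exists_longest_palindromic_suffix (u ++ [y])
  rw [hcl]
  have hq' := (reverse_muL_append_singleton_eq_iff x q).2 hq
  rcases eq_or_eq_not x y with rfl | rfl
  · have hW : muL y u ++ [y, y] = muL y p ++ (muL y q ++ [y]) := by
      rw [← List.append_assoc, ← muL_append, ← hw]; simp
    rw [hW, palClosure_eq hq']
    · rw [hw]
      simp [cons_reverse_muL]
    · rintro P (_ | ⟨c, Q⟩) h hQ
      · simp
      · obtain rfl : c = y := head_eq_of_reverse_eq (W := muL y p ++ muL y q) hQ (by simpa using h)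
        rw [← List.append_assoc, ← muL_append] at h
        obtain ⟨p', q', h₁, rfl, h₂⟩ := exists_split_of_muL_append_eq h
        rw [h₂, reverse_muL_append_singleton_eq_iff] at hQ
        have := length_muL_le_of_append_eq (x := c) h₁ (hmax p' q' (hw.trans h₁) hQ)
        rw [h₂]
        simpa using this
  · have hne : q ≠ [] := by
      rintro rfl
      simpa using hmax u [!x] rfl rfl
    obtain ⟨c, r, rfl⟩ := List.exists_cons_of_ne_nil hne
    obtain rfl : c = !x := head_eq_of_reverse_eq hq hw
    have hW : muL x u ++ [x, !x] = (muL x p ++ [x]) ++ ((!x) :: muL x r) := by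
      have := congrArg (muL x) hw
      simpa using this
    have hQ₀ : ((!x) :: muL x r).reverse = (!x) :: muL x r := by
      rw [muL_cons_not, List.cons_append, List.reverse_cons, List.reverse_append,
        List.reverse_singleton, List.singleton_append, List.cons_append,
        List.cons.injEq, List.append_left_inj] at hq'
      exact hq'.2
    rw [hW, palClosure_eq hQ₀]
    · rw [hw]
      simp [cons_reverse_muL]
    · rintro P (_ | ⟨c, Q⟩) h hQ
      · simp
      · obtain rfl : c = !x :=
          head_eq_of_reverse_eq (W := muL x u ++ [x]) hQ (by rw [← h, ← hW]; simp)
        have hwQ : muL x (p ++ (!x) :: r) = P ++ (!x) :: Q := by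
          rw [← h]; simp
        obtain ⟨P, rfl⟩ := exists_eq_append_of_muL_eq hwQ
        have hWx : muL x (p ++ (!x) :: r) ++ [x] = P ++ x :: ((!x) :: Q ++ [x]) := by
          rw [hwQ]; simp
        obtain ⟨p', q', h₁, rfl, h₂⟩ := exists_split_of_muL_append_eq hWx
        have hpal : (x :: ((!x) :: Q ++ [x])).reverse = x :: ((!x) :: Q ++ [x]) := by
          rw [List.reverse_cons, List.reverse_append, hQ]; simp
        rw [h₂, reverse_muL_append_singleton_eq_iff] at hpal
        have h₃ := length_muL_le_of_append_eq (x := x) h₁ (hmax p' q' (hw.trans h₁) hpal)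
        have h₄ := congrArg List.length h₂
        simp at h₃ h₄ ⊢
        omega

lemma psi_append_singleton (v : List Bool) (y : Bool) :
    psi (v ++ [y]) = palClosure (psi v ++ [y]) := by
  simp [psi]

lemma psi_cons (x : Bool) (v : List Bool) : psi (x :: v) = muL x (psi v) ++ [x] := by
  induction v using List.reverseRecOn with
  | nil => cases x <;> rfl
  | append_singleton v y ih =>
    rw [← List.cons_append, psi_append_singleton, ih, psi_append_singleton,
      ← palClosure_muL_append]
    simp

lemma psi_injective : Function.Injective psi := by
  intro u
  induction u with
  | nil =>
    rintro (_ | ⟨d, v⟩) h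
    · rfl
    · rw [psi_cons] at h
      simp [psi] at h
  | cons c u ih =>
    rintro (_ | ⟨d, v⟩) h
    · rw [psi_cons] at h
      simp [psi] at h
    · rw [psi_cons, psi_cons] at h
      obtain rfl : c = d := by
        simpa using congrArg List.getLast? h
      rw [List.append_left_inj] at h
      rw [ih (muL_injective c h)]

/-! ### Christoffel words as images of `lamL` -/

@[simp] lemma lamL_append (x : Bool) (u v : List Bool) :
    lamL x (u ++ v) = lamL x u ++ lamL x v := by
  cases x <;> exact applyM_append _ _ _

lemma lamL_false : lamL false = muL false := by
  refine congrArg applyM (funext fun y => ?_)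
  cases y <;> simp

lemma cons_lamL_true (u : List Bool) : true :: lamL true u = muL true u ++ [true] := by
  induction u with
  | nil => rfl
  | cons c u ih =>
    cases c
    · change true :: false :: true :: lamL true u = true :: false :: (muL true u ++ [true])
      rw [ih]
    · change true :: true :: lamL true u = true :: (muL true u ++ [true])
      rw [ih]

lemma lamL_injective (x : Bool) : Function.Injective (lamL x) := by
  cases x
  · rw [lamL_false]
    exact muL_injective false
  · intro u v h
    have := congrArg (true :: ·) h
    simp only [cons_lamL_true, List.append_left_inj] at this
    exact muL_injective true this

/-- The proper Christoffel word with directive word `v`. -/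
def christoffel (v : List Bool) : List Bool := false :: (psi v ++ [true])

lemma christoffel_injective : Function.Injective christoffel := by
  intro u v h
  simp only [christoffel, List.cons.injEq, true_and, List.append_left_inj] at h
  exact psi_injective h

lemma christoffel_cons (x : Bool) (v : List Bool) :
    christoffel (x :: v) = lamL x (christoffel v) := by
  unfold christoffel
  rw [psi_cons, ← List.singleton_append, ← List.singleton_append (l := psi v ++ [true])]
  cases x
  · rw [lamL_append, lamL_append, lamL_false, List.append_assoc]
    rfl
  · rw [lamL_append, lamL_append, ← cons_lamL_true]
    rfl

lemma christoffel_replicate_append (x : Bool) (k : ℕ) (v : List Bool) :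
    christoffel (List.replicate k x ++ v) = (lamL x)^[k] (christoffel v) := by
  induction k with
  | zero => rfl
  | succ k ih =>
    rw [List.replicate_succ, List.cons_append, christoffel_cons, ih,
      Function.iterate_succ_apply']

lemma lamL_false_replicate (k : ℕ) :
    lamL false (List.replicate k false) = List.replicate k false := by
  induction k with
  | zero => rfl
  | succ k ih => exact congrArg (false :: ·) ih

lemma lamL_true_replicate (k : ℕ) :
    lamL true (List.replicate k true) = List.replicate k true := by
  induction k with
  | zero => rfl
  | succ k ih => exact congrArg (true :: ·) ih

lemma phi_eq_iterate (k : ℕ) : phi k = (lamL false)^[k] ∘ lamL true := by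
  induction k with
  | zero =>
    funext w
    induction w with
    | nil => rfl
    | cons c w ih => cases c <;> simpa [phi, lamL, applyM] using ih
  | succ k ih =>
    rw [Function.iterate_succ', Function.comp_assoc, ← ih]
    funext w
    induction w with
    | nil => rfl
    | cons c w ih =>
      rw [phi, applyM_cons, ← phi, ih, Function.comp_apply, Function.comp_apply, phi,
        applyM_cons, lamL_append]
      congr 1
      cases c <;> simp only [lamL_append, lamL_false_replicate, if_true, reduceCtorEq, if_false] <;>
        simp [lamL, applyM, List.replicate_succ']

lemma phiHat_eq_iterate (k : ℕ) : phiHat k = (lamL true)^[k] ∘ lamL false := by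
  induction k with
  | zero =>
    funext w
    induction w with
    | nil => rfl
    | cons c w ih => cases c <;> simp [phiHat, lamL, applyM]
  | succ k ih =>
    rw [Function.iterate_succ', Function.comp_assoc, ← ih]
    funext w
    induction w with
    | nil => rfl
    | cons c w ih =>
      rw [phiHat, applyM_cons, ← phiHat, ih, Function.comp_apply, Function.comp_apply, phiHat,
        applyM_cons, lamL_append]
      congr 1
      cases c <;> simp only [if_true, reduceCtorEq, if_false] <;>
        rw [← List.singleton_append (l := List.replicate _ true) (x := false),
          ← List.singleton_append (l := List.replicate _ true) (x := false),
          lamL_append, lamL_true_replicate] <;>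
        simp [lamL, applyM, List.replicate_succ]

lemma phi_injective (k : ℕ) : Function.Injective (phi k) := by
  rw [phi_eq_iterate]
  exact ((lamL_injective _).iterate k).comp (lamL_injective _)

lemma phiHat_injective (k : ℕ) : Function.Injective (phiHat k) := by
  rw [phiHat_eq_iterate]
  exact ((lamL_injective _).iterate k).comp (lamL_injective _)

/-! ### Derivatives -/

lemma derivC_christoffel {v : List Bool} (hv : v ≠ []) :
    derivC (christoffel v) =
      if v.headD false = false then Function.invFun (phi (blockLen v)) (christoffel v)
      else Function.invFun (phiHat (blockLen v)) (christoffel v) := by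
  have h : ∃ u, u ≠ [] ∧ christoffel v = false :: (psi u ++ [true]) := ⟨v, hv, rfl⟩
  have hne : christoffel v ≠ [false, true] := fun h' =>
    hv (christoffel_injective (h'.trans rfl : christoffel v = christoffel []))
  have hc : h.choose = v := (christoffel_injective h.choose_spec.2).symm
  rw [derivC, if_neg hne, dif_pos h, hc]

lemma derivC_christoffel_false {k : ℕ} {v u : List Bool} (hv : v ≠ [])
    (hh : v.headD false = false) (hk : blockLen v = k) (h : christoffel v = phi k u) :
    derivC (christoffel v) = u := by
  rw [derivC_christoffel hv, if_pos hh, hk, h]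
  exact Function.leftInverse_invFun (phi_injective k) u

lemma derivC_christoffel_true {k : ℕ} {v u : List Bool} (hv : v ≠ [])
    (hh : v.headD false = true) (hk : blockLen v = k) (h : christoffel v = phiHat k u) :
    derivC (christoffel v) = u := by
  rw [derivC_christoffel hv, if_neg (by rw [hh]; simp), hk, h]
  exact Function.leftInverse_invFun (phiHat_injective k) u

/-- A word of the form `[a]` or `[b]`. -/
def IsLetter (w : List Bool) : Prop := w = [false] ∨ w = [true]

lemma not_isLetter_christoffel (v : List Bool) : ¬ IsLetter (christoffel v) := by
  simp [IsLetter, christoffel]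

lemma derivC_of_isLetter {w : List Bool} (hw : IsLetter w) : derivC w = w := by
  have h : ¬ ∃ v, v ≠ [] ∧ w = false :: (psi v ++ [true]) := by
    rintro ⟨v, -, rfl⟩
    exact not_isLetter_christoffel v hw
  have hne : w ≠ [false, true] := by
    rcases hw with rfl | rfl <;> simp
  rw [derivC, if_neg hne, dif_neg h]

lemma isLetter_iterate_derivC {w : List Bool} (hw : IsLetter w) (d : ℕ) :
    IsLetter (derivC^[d] w) := by
  rwa [Function.iterate_fixed (derivC_of_isLetter hw)]

lemma isLetter_derivC_christoffel_of_isConstant {v : List Bool} (hv : IsConstant v) :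
    IsLetter (derivC (christoffel v)) := by
  obtain ⟨x, k, rfl⟩ := hv
  rcases k with _ | k
  · left
    exact if_pos rfl
  · have hne : List.replicate (k + 1) x ≠ [] := by simp
    have hk : blockLen (List.replicate (k + 1) x) = k + 1 := by
      simp [blockLen, List.replicate_succ]
    have hC := christoffel_replicate_append x (k + 1) []
    rw [List.append_nil] at hC
    cases x
    · left
      refine derivC_christoffel_false hne rfl hk (hC.trans ?_)
      rw [phi_eq_iterate]; rfl
    · right
      refine derivC_christoffel_true hne rfl hk (hC.trans ?_)
      rw [phiHat_eq_iterate]; rfl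

lemma isConstant_or_exists_eq (v : List Bool) :
    IsConstant v ∨ ∃ x k u, v = List.replicate (k + 1) x ++ (!x) :: u := by
  induction v with
  | nil => exact Or.inl ⟨false, 0, rfl⟩
  | cons c v ih =>
    rcases ih with ⟨x, n, rfl⟩ | ⟨x, k, u, rfl⟩
    · rcases eq_or_eq_not x c with rfl | rfl
      · exact Or.inl ⟨c, n + 1, rfl⟩
      · rcases n with _ | n
        · exact Or.inl ⟨!x, 1, rfl⟩
        · exact Or.inr ⟨!x, 0, List.replicate n x, by simp [List.replicate_succ]⟩
    · rcases eq_or_eq_not x c with rfl | rfl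
      · exact Or.inr ⟨c, k + 1, u, rfl⟩
      · exact Or.inr ⟨!x, 0, List.replicate k x ++ (!x) :: u, by simp [List.replicate_succ]⟩

lemma plusV_replicate_append (x : Bool) (k : ℕ) (u : List Bool) :
    plusV (List.replicate (k + 1) x ++ (!x) :: u) = u := by
  simp [plusV, List.replicate_succ]

lemma blockLen_replicate_append (x : Bool) (k : ℕ) (u : List Bool) :
    blockLen (List.replicate (k + 1) x ++ (!x) :: u) = k + 1 := by
  simp [blockLen, List.replicate_succ]

lemma derivC_christoffel_of_not_isConstant {v : List Bool} (hv : ¬ IsConstant v) :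
    derivC (christoffel v) = christoffel (plusV v) := by
  obtain ⟨x, k, u, rfl⟩ := (isConstant_or_exists_eq v).resolve_left hv
  rw [plusV_replicate_append]
  have hC := christoffel_replicate_append x (k + 1) ((!x) :: u)
  rw [christoffel_cons] at hC
  have hk := blockLen_replicate_append x k u
  cases x
  · refine derivC_christoffel_false (by simp) rfl hk (hC.trans ?_)
    rw [phi_eq_iterate]; rfl
  · refine derivC_christoffel_true (by simp) rfl hk (hC.trans ?_)
    rw [phiHat_eq_iterate]; rfl

lemma plusV_of_isConstant {v : List Bool} (hv : IsConstant v) : plusV v = [] := by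
  obtain ⟨x, _ | k, rfl⟩ := hv
  · rfl
  · simp [plusV, List.replicate_succ]

lemma isConstant_iterate_plusV {v : List Bool} (hv : IsConstant v) (n : ℕ) :
    IsConstant (plusV^[n] v) := by
  induction n generalizing v with
  | zero => exact hv
  | succ n ih =>
    rw [Function.iterate_succ_apply, plusV_of_isConstant hv]
    exact ih ⟨false, 0, rfl⟩

lemma isLetter_iterate_derivC_christoffel_iff (d : ℕ) (v : List Bool) :
    IsLetter (derivC^[d] (christoffel v)) ↔ 0 < d ∧ IsConstant (plusV^[d - 1] v) := by
  induction d generalizing v with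
  | zero => simpa using not_isLetter_christoffel v
  | succ d ih =>
    rw [Function.iterate_succ_apply]
    by_cases hv : IsConstant v
    · exact iff_of_true (isLetter_iterate_derivC (isLetter_derivC_christoffel_of_isConstant hv) d)
        ⟨d.succ_pos, isConstant_iterate_plusV hv _⟩
    · rw [derivC_christoffel_of_not_isConstant hv, ih]
      rcases d with _ | d
      · simpa using hv
      · simp [Function.iterate_succ_apply]

/-- the depth of the proper Christoffel word a·ψ(v)·b equals the
height of its directive word v. -/
theorem depth_eq_height (v w : List Bool) (hw : w = false :: (psi v ++ [true])) :
    depth w = height v := by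
  subst hw
  unfold depth height
  congr 1
  ext d
  exact isLetter_iterate_derivC_christoffel_iff d v

end Chri
end

section
/- For all integers k > 0 and p > 0, the number J_k(p) of words v of length k over A = {a,b} with h(v) = p satisfies J_k(p) = 2^{p−1}·( C(k−p+1, p−1) + C(k−p, p−1) ), where C(n,m) denotes the binomial coefficient with the convention C(n,m) = 0 when n < m. -/
namespace Chri

attribute [local instance] Classical.propDecidable

lemma isConstant_nil : IsConstant [] := ⟨false, 0, rfl⟩

lemma isConstant_singleton (x : Bool) : IsConstant [x] := ⟨x, 1, rfl⟩

lemma not_isConstant_cons_not (x : Bool) (u : List Bool) : ¬ IsConstant (x :: (!x) :: u) := by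
  rintro ⟨y, n, h⟩
  have h₁ : x = y := List.eq_of_mem_replicate (n := n) (by simp [← h])
  have h₂ : (!x) = y := List.eq_of_mem_replicate (n := n) (by simp [← h])
  cases x <;> simp_all

lemma isConstant_cons_cons_self (x : Bool) (u : List Bool) :
    IsConstant (x :: x :: u) ↔ IsConstant (x :: u) := by
  constructor
  · rintro ⟨y, n, h⟩
    refine ⟨y, n - 1, ?_⟩
    simpa using congrArg List.tail h
  · rintro ⟨y, n, h⟩
    have hx : x = y := List.eq_of_mem_replicate (n := n) (by simp [← h])
    exact ⟨y, n + 1, by rw [List.replicate_succ, ← h, hx]⟩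

lemma plusV_cons_cons_self (x : Bool) (u : List Bool) :
    plusV (x :: x :: u) = plusV (x :: u) := by
  simp [plusV]

lemma plusV_cons_not (x : Bool) (u : List Bool) : plusV (x :: (!x) :: u) = u := by
  cases x <;> simp [plusV]

lemma length_plusV_le (v : List Bool) : (plusV v).length ≤ v.length - 1 := by
  have := (List.dropWhile_suffix (l := v) fun y => y == v.headD false).length_le
  simp only [plusV, List.length_tail]
  omega

lemma length_iterate_plusV_le (n : ℕ) (v : List Bool) :
    (plusV^[n] v).length ≤ v.length - n := by
  induction n with
  | zero => simp
  | succ n ih =>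
    rw [Function.iterate_succ_apply']
    have := length_plusV_le (plusV^[n] v)
    omega

/-- The infimum defining the height is attained. -/
lemma isLeast_height (v : List Bool) :
    IsLeast {n | 0 < n ∧ IsConstant (plusV^[n - 1] v)} (height v) := by
  refine ⟨Nat.sInf_mem ⟨v.length + 1, Nat.succ_pos _, ?_⟩, fun _ hn => Nat.sInf_le hn⟩
  have h := length_iterate_plusV_le v.length v
  rw [Nat.sub_self, Nat.le_zero, List.length_eq_zero_iff] at h
  rw [Nat.add_sub_cancel, h]
  exact isConstant_nil

lemma height_pos (v : List Bool) : 0 < height v := (isLeast_height v).1.1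

lemma height_of_isConstant {v : List Bool} (hv : IsConstant v) : height v = 1 :=
  le_antisymm ((isLeast_height v).2 ⟨one_pos, hv⟩) (height_pos v)

lemma height_of_not_isConstant {v : List Bool} (hv : ¬ IsConstant v) :
    height v = height (plusV v) + 1 := by
  have hw := isLeast_height (plusV v)
  refine (isLeast_height v).unique ⟨⟨Nat.succ_pos _, ?_⟩, ?_⟩
  · obtain ⟨m, hm⟩ := Nat.exists_eq_succ_of_ne_zero hw.1.1.ne'
    have := hw.1.2
    rw [hm] at this ⊢
    simpa using this
  · rintro n ⟨hn, hc⟩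
    match n, hn, hc with
    | 1, _, hc => exact absurd hc hv
    | n + 2, _, hc => exact Nat.succ_le_succ (hw.2 ⟨Nat.succ_pos n, by simpa using hc⟩)

lemma height_cons_cons_self (x : Bool) (u : List Bool) :
    height (x :: x :: u) = height (x :: u) := by
  by_cases h : IsConstant (x :: u)
  · rw [height_of_isConstant h, height_of_isConstant ((isConstant_cons_cons_self x u).2 h)]
  · rw [height_of_not_isConstant h, ← plusV_cons_cons_self,
      ← height_of_not_isConstant (mt (isConstant_cons_cons_self x u).1 h)]

lemma height_cons_not (x : Bool) (u : List Bool) :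
    height (x :: (!x) :: u) = height u + 1 := by
  rw [height_of_not_isConstant (not_isConstant_cons_not x u), plusV_cons_not]

/-- The set of words of length `k` and height `p`. -/
def wordsOfHeight (k p : ℕ) : Set (List Bool) := {v | v.length = k ∧ height v = p}

lemma finite_wordsOfHeight (k p : ℕ) : (wordsOfHeight k p).Finite :=
  (List.finite_length_eq Bool k).subset fun _ hv => hv.1

lemma wordsOfHeight_add_two (k p : ℕ) :
    wordsOfHeight (k + 2) (p + 1) =
      (fun v : List Bool => v.headD false :: v) '' wordsOfHeight (k + 1) (p + 1) ∪
        ((fun u => false :: true :: u) '' wordsOfHeight k p ∪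
          (fun u => true :: false :: u) '' wordsOfHeight k p) := by
  ext v
  constructor
  · rintro ⟨hl, hh⟩
    match v, hl, hh with
    | x :: y :: u, hl, hh =>
      by_cases hxy : y = x
      · subst hxy
        rw [height_cons_cons_self] at hh
        exact Or.inl ⟨y :: u, ⟨by simpa using hl, hh⟩, rfl⟩
      · obtain rfl : y = !x := by cases x <;> cases y <;> simp_all
        rw [height_cons_not] at hh
        have hu : u ∈ wordsOfHeight k p := ⟨by simpa using hl, by omega⟩
        cases x
        · exact Or.inr (Or.inl ⟨u, hu, rfl⟩)
        · exact Or.inr (Or.inr ⟨u, hu, rfl⟩)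
  · rintro (⟨v, ⟨hl, hh⟩, rfl⟩ | ⟨u, ⟨hl, hh⟩, rfl⟩ | ⟨u, ⟨hl, hh⟩, rfl⟩)
    · match v, hl, hh with
      | x :: u, hl, hh =>
        exact ⟨by simpa using hl, (height_cons_cons_self x u).trans hh⟩
    · exact ⟨by simpa using hl, (height_cons_not false u).trans (by rw [hh])⟩
    · exact ⟨by simpa using hl, (height_cons_not true u).trans (by rw [hh])⟩

lemma ncard_wordsOfHeight_add_two (k p : ℕ) :
    (wordsOfHeight (k + 2) (p + 1)).ncard =
      (wordsOfHeight (k + 1) (p + 1)).ncard + 2 * (wordsOfHeight k p).ncard := by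
  have hk := finite_wordsOfHeight k p
  rw [wordsOfHeight_add_two, Set.ncard_union_eq _ ((finite_wordsOfHeight _ _).image _)
      ((hk.image _).union (hk.image _)),
    Set.ncard_union_eq _ (hk.image _) (hk.image _),
    Set.ncard_image_of_injective _ fun _ _ h => (List.cons.inj h).2,
    Set.ncard_image_of_injective _ fun _ _ h => by simpa using h,
    Set.ncard_image_of_injective _ fun _ _ h => by simpa using h]
  · ring
  · rw [Set.disjoint_left]
    rintro _ ⟨u, -, rfl⟩ ⟨w, -, h⟩
    simp at h
  · rw [Set.disjoint_left]
    rintro _ ⟨v, -, rfl⟩ (⟨w, -, h⟩ | ⟨w, -, h⟩) <;>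
      · obtain ⟨h₁, rfl⟩ := List.cons.inj h
        simp at h₁

lemma wordsOfHeight_zero_right (k : ℕ) : wordsOfHeight k 0 = ∅ :=
  Set.eq_empty_of_forall_notMem fun v hv => (height_pos v).ne' hv.2

lemma ncard_wordsOfHeight_zero (p : ℕ) :
    (wordsOfHeight 0 p).ncard = if p = 1 then 1 else 0 := by
  have h : height [] = 1 := height_of_isConstant isConstant_nil
  split_ifs with hp
  · rw [Set.ncard_eq_one]
    refine ⟨[], Set.ext fun v => ⟨fun hv => List.length_eq_zero_iff.1 hv.1, ?_⟩⟩
    rintro rfl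
    exact ⟨rfl, h.trans hp.symm⟩
  · rw [Set.ncard_eq_zero (finite_wordsOfHeight _ _)]
    refine Set.eq_empty_of_forall_notMem fun v hv => hp ?_
    rw [← hv.2, List.length_eq_zero_iff.1 hv.1, h]

lemma ncard_wordsOfHeight_one (p : ℕ) :
    (wordsOfHeight 1 p).ncard = if p = 1 then 2 else 0 := by
  have h (x : Bool) : height [x] = 1 := height_of_isConstant (isConstant_singleton x)
  split_ifs with hp
  · rw [Set.ncard_eq_two]
    refine ⟨[false], [true], by simp, Set.ext fun v => ⟨fun hv => ?_, ?_⟩⟩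
    · obtain ⟨x, rfl⟩ := List.length_eq_one_iff.1 hv.1
      cases x <;> simp
    · rintro (rfl | rfl) <;> exact ⟨rfl, (h _).trans hp.symm⟩
  · rw [Set.ncard_eq_zero (finite_wordsOfHeight _ _)]
    refine Set.eq_empty_of_forall_notMem fun v hv => hp ?_
    obtain ⟨x, rfl⟩ := List.length_eq_one_iff.1 hv.1
    rw [← hv.2, h]

/-- Pascal's rule with truncated subtraction in the upper index. -/
lemma choose_sub_succ (n p : ℕ) :
    (n + 1 - p).choose (p + 1) = (n - p).choose (p + 1) + (n - p).choose p := by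
  rcases le_or_gt p n with hpn | hpn
  · rw [Nat.sub_add_comm hpn, Nat.choose_succ_succ', add_comm]
  · rw [Nat.choose_eq_zero_of_lt (by omega), Nat.choose_eq_zero_of_lt (by omega),
      Nat.choose_eq_zero_of_lt (by omega)]

lemma ncard_wordsOfHeight_succ (k p : ℕ) :
    (wordsOfHeight (k + 1) (p + 1)).ncard =
      2 ^ p * ((k + 1 - p).choose p + (k - p).choose p) := by
  induction k using Nat.twoStepInduction generalizing p with
  | zero =>
    rw [ncard_wordsOfHeight_one]
    rcases p with _ | p
    · simp
    · simp [Nat.choose_eq_zero_of_lt]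
  | one =>
    rw [ncard_wordsOfHeight_add_two, ncard_wordsOfHeight_one, ncard_wordsOfHeight_zero]
    rcases p with _ | _ | p
    · simp
    · simp
    · simp [Nat.choose_eq_zero_of_lt]
  | more k ih₀ ih₁ =>
    rw [ncard_wordsOfHeight_add_two, ih₁]
    rcases p with _ | p
    · simp [wordsOfHeight_zero_right]
    · rw [ih₀, show k + 1 + 1 + 1 - (p + 1) = k + 1 + 1 - p by omega,
        show k + 1 + 1 - (p + 1) = k + 1 - p by omega,
        show k + 1 - (p + 1) = k - p by omega,
        choose_sub_succ (k + 1), choose_sub_succ k]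
      ring

/-- the number of words of length k and height p is
2^{p−1}·(C(k−p+1, p−1) + C(k−p, p−1)). -/
theorem card_words_of_height (k p : ℕ) (hk : 0 < k) (hp : 0 < p) :
    {v : List Bool | v.length = k ∧ height v = p}.ncard =
      2 ^ (p - 1) * (Nat.choose (k + 1 - p) (p - 1) + Nat.choose (k - p) (p - 1)) := by
  obtain ⟨k, rfl⟩ := Nat.exists_eq_succ_of_ne_zero hk.ne'
  obtain ⟨p, rfl⟩ := Nat.exists_eq_succ_of_ne_zero hp.ne'
  simpa [wordsOfHeight] using ncard_wordsOfHeight_succ k p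

end Chri
end
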